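/- Let Φ be strictly plurisubharmonic quadratic on ℂ^n with polarization ψ. The integral operator Π with kernel Π(x,y) = (2^n det ψ''_{xy}/(πh)^n) e^{2ψ(x,ȳ)/h} e^{−2Φ(y)/h} (acting on L²(ℂ^n, e^{−2Φ/h}L(dx))) is bounded uniformly in h ∈ (0,1]: there is C such that ‖Πu‖_{L²_Φ} ≤ C‖u‖_{L²_Φ} for all u and all h. -/

import Mathlib

open scoped BigOperators ComplexOrder ENNReal
open MeasureTheory

noncomputable def dotC {n : ℕ} (x y : Fin n → ℂ) : ℂ := ∑ j, x j * y j

/-- The strictly plurisubharmonic quadratic weight `Φ(x) = Re(Px·x) + Hx·x̄`. -/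
noncomputable def PhiW {n : ℕ} (P H : Matrix (Fin n) (Fin n) ℂ) (x : Fin n → ℂ) : ℝ :=
  (dotC (P.mulVec x) x).re + (dotC (H.mulVec x) (star x)).re

/-- The polarization `ψ(x,y)` of `Φ`, with `ψ''_{xy} = Φ''_{x̄x} = H`. -/
noncomputable def psiW {n : ℕ} (P H : Matrix (Fin n) (Fin n) ℂ) (x y : Fin n → ℂ) : ℂ :=
  (1/2) * dotC (P.mulVec x) x + dotC (H.mulVec x) y +
    (1/2) * dotC ((P.map (starRingEnd ℂ)).mulVec y) y

/-- The Bergman-type projector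
`Πu(x) = (2ⁿ det ψ''_{xy}/(πh)ⁿ) ∫ e^{2ψ(x,ȳ)/h} u(y) e^{−2Φ(y)/h} L(dy)`. -/
noncomputable def PiOp {n : ℕ} (P H : Matrix (Fin n) (Fin n) ℂ) (h : ℝ)
    (u : (Fin n → ℂ) → ℂ) (x : Fin n → ℂ) : ℂ :=
  ((2 : ℂ)^n * H.det / ((Real.pi : ℂ) * (h : ℂ))^n) *
    ∫ y : Fin n → ℂ,
      Complex.exp (2 * psiW P H x (star y) / (h : ℂ)) * u y *
        (Real.exp (-2 * PhiW P H y / h) : ℂ)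

noncomputable def qH {n : ℕ} (H : Matrix (Fin n) (Fin n) ℂ) (x : Fin n → ℂ) : ℝ :=
  (dotC (H.mulVec x) (star x)).re

lemma dotC_eq {n : ℕ} (x y : Fin n → ℂ) : dotC x y = x ⬝ᵥ y := rfl

lemma herm_swap {n : ℕ} {H : Matrix (Fin n) (Fin n) ℂ} (hH : H.IsHermitian)
    (x y : Fin n → ℂ) :
    (dotC (H.mulVec y) (star x)).re = (dotC (H.mulVec x) (star y)).re := by
  have : dotC (H.mulVec y) (star x) = star (dotC (H.mulVec x) (star y)) := by
    rw [dotC_eq, dotC_eq, Matrix.dotProduct_star, Matrix.star_mulVec, hH.eq,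
      dotProduct_comm x, ← Matrix.dotProduct_mulVec, dotProduct_comm (star y)]
  rw [this]; simp

lemma conjP {n : ℕ} (P : Matrix (Fin n) (Fin n) ℂ) (y : Fin n → ℂ) :
    dotC ((P.map (starRingEnd ℂ)).mulVec (star y)) (star y) = star (dotC (P.mulVec y) y) := by
  simp [dotC, Matrix.mulVec, dotProduct, map_sum, map_mul]

lemma key {n : ℕ} (P H : Matrix (Fin n) (Fin n) ℂ) (hH : H.IsHermitian) (x y : Fin n → ℂ) :
    2 * (psiW P H x (star y)).re = PhiW P H x + PhiW P H y - qH H (x - y) := by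
  have h1 : qH H (x - y) = qH H x + qH H y - 2 * (dotC (H.mulVec x) (star y)).re := by
    have := herm_swap hH x y
    simp only [qH, dotC_eq, Matrix.mulVec_sub, star_sub, sub_dotProduct, dotProduct_sub,
      Complex.sub_re] at this ⊢
    rw [this]; ring
  rw [h1]
  simp only [psiW, PhiW, qH, conjP]
  have h2 (z : ℂ) : ((1/2 : ℂ) * z).re = z.re / 2 := by
    simp [Complex.mul_re]; ring
  simp only [Complex.add_re, h2]
  simp
  ring

lemma q_smul {n : ℕ} (H : Matrix (Fin n) (Fin n) ℂ) (c : ℝ) (x : Fin n → ℂ) :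
    qH H ((c : ℂ) • x) = c ^ 2 * qH H x := by
  simp only [qH, dotC_eq, Matrix.mulVec_smul, star_smul, smul_dotProduct, dotProduct_smul]
  simp; ring

lemma q_cont {n : ℕ} (H : Matrix (Fin n) (Fin n) ℂ) : Continuous (qH H) := by
  unfold qH dotC Matrix.mulVec dotProduct
  simp only [Pi.star_apply]
  fun_prop

lemma q_pos {n : ℕ} {H : Matrix (Fin n) (Fin n) ℂ} (hH : H.PosDef) {x : Fin n → ℂ}
    (hx : x ≠ 0) : 0 < qH H x := by
  have := hH.dotProduct_mulVec_pos hx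
  rw [dotProduct_comm] at this
  exact (Complex.pos_iff.1 this).1

lemma q_lower {n : ℕ} {H : Matrix (Fin n) (Fin n) ℂ} (hH : H.PosDef) :
    ∃ d : ℝ, 0 < d ∧ ∀ x : Fin n → ℂ, d * ∑ i, ‖x i‖ ^ 2 ≤ qH H x := by
  have h0 : ∃ m : ℝ, 0 < m ∧ ∀ x : Fin n → ℂ, ‖x‖ = 1 → m ≤ qH H x := by
    rcases (Metric.sphere (0 : Fin n → ℂ) 1).eq_empty_or_nonempty with he | hne
    · refine ⟨1, one_pos, fun x hx => ?_⟩
      have : x ∈ Metric.sphere (0 : Fin n → ℂ) 1 := by simpa using hx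
      rw [he] at this; exact this.elim
    · obtain ⟨z, hz, hmin⟩ := (isCompact_sphere (0 : Fin n → ℂ) 1).exists_isMinOn hne
        (q_cont H).continuousOn
      refine ⟨qH H z, q_pos hH ?_, fun x hx => hmin (by simpa using hx)⟩
      rintro rfl; simp at hz
  obtain ⟨m, hm, hq⟩ := h0
  refine ⟨m / (n + 1), by positivity, fun x => ?_⟩
  have h1 : m * ‖x‖ ^ 2 ≤ qH H x := by
    by_cases hx : x = 0
    · subst hx; simp [qH, dotC_eq]
    · have hx' : 0 < ‖x‖ := norm_pos_iff.2 hx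
      have := hq (((‖x‖⁻¹ : ℝ) : ℂ) • x) (by
        rw [norm_smul, Complex.norm_real, norm_inv, norm_norm, inv_mul_cancel₀ hx'.ne'])
      rw [q_smul, inv_pow, ← div_eq_inv_mul, le_div_iff₀ (by positivity)] at this
      exact this
  have h2 : ∑ i, ‖x i‖ ^ 2 ≤ (n + 1) * ‖x‖ ^ 2 := by
    calc ∑ i, ‖x i‖ ^ 2 ≤ ∑ i : Fin n, ‖x‖ ^ 2 :=
          Finset.sum_le_sum fun i _ => by gcongr; exact norm_le_pi_norm x i
      _ = n * ‖x‖ ^ 2 := by simp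
      _ ≤ _ := by gcongr; linarith
  calc m / (n + 1) * ∑ i, ‖x i‖ ^ 2 ≤ m / (n + 1) * ((n + 1) * ‖x‖ ^ 2) := by gcongr
    _ = m * ‖x‖ ^ 2 := by field_simp
    _ ≤ _ := h1

lemma gauss_bound {n : ℕ} {b : ℝ} (hb : 0 < b) :
    ∫⁻ x : Fin n → ℂ, ENNReal.ofReal (Real.exp (-b * ∑ i, ‖x i‖ ^ 2)) =
      ENNReal.ofReal ((Real.pi / b) ^ n) := by
  have h1 : ∫ v : ℂ, Real.exp (-b * ‖v‖ ^ 2) = Real.pi / b := by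
    rw [GaussianFourier.integral_rexp_neg_mul_sq_norm hb]; simp
  have hi : Integrable (fun v : ℂ => Real.exp (-b * ‖v‖ ^ 2)) := by
    by_contra hc
    rw [integral_undef hc] at h1
    have : 0 < Real.pi / b := by positivity
    linarith
  have he : (fun x : Fin n → ℂ => Real.exp (-b * ∑ i, ‖x i‖ ^ 2)) =
      fun x => ∏ i, Real.exp (-b * ‖x i‖ ^ 2) := by
    funext x; rw [Finset.mul_sum, Real.exp_sum]
  have hI : Integrable (fun x : Fin n → ℂ => ∏ i, Real.exp (-b * ‖x i‖ ^ 2)) :=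
    Integrable.fintype_prod (f := fun (_ : Fin n) (v : ℂ) => Real.exp (-b * ‖v‖ ^ 2))
      (fun _ => hi)
  rw [← he] at hI
  rw [← ofReal_integral_eq_lintegral_ofReal hI (ae_of_all _ fun _ => (Real.exp_pos _).le), he,
    integral_fintype_prod_volume_eq_pow (fun v : ℂ => Real.exp (-b * ‖v‖ ^ 2)), h1]
  simp

lemma cs {α : Type*} [MeasurableSpace α] (μ : Measure α) {g v : α → ℝ≥0∞}
    (hg : Measurable g) (hv : Measurable v) :
    (∫⁻ a, g a * v a ∂μ) ^ 2 ≤ (∫⁻ a, g a ∂μ) * ∫⁻ a, g a * v a ^ 2 ∂μ := by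
  have hp : (2 : ℝ).HolderConjugate 2 := Real.HolderConjugate.two_two
  have := ENNReal.lintegral_mul_le_Lp_mul_Lq μ hp (f := fun a => g a ^ (1/2 : ℝ))
    (g := fun a => g a ^ (1/2 : ℝ) * v a) (by fun_prop) (by fun_prop)
  have e1 (t : ℝ≥0∞) : (t ^ (1/2 : ℝ)) ^ (2 : ℝ) = t := by
    rw [← ENNReal.rpow_mul]; norm_num
  have e2 (t : ℝ≥0∞) : t ^ (1/2 : ℝ) * t ^ (1/2 : ℝ) = t := by
    rw [← ENNReal.rpow_add_of_nonneg _ _ (by norm_num) (by norm_num)]; norm_num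
  simp only [Pi.mul_apply, ← mul_assoc, e2, ENNReal.mul_rpow_of_nonneg _ _ (zero_le_two (α := ℝ)),
    e1] at this
  simp only [ENNReal.rpow_two] at this
  calc _ ≤ _ := pow_le_pow_left' this 2
    _ = _ := by rw [mul_pow, ← ENNReal.rpow_two, ← ENNReal.rpow_two, e1, e1]

lemma schur {n : ℕ} {g v : (Fin n → ℂ) → ℝ≥0∞} (hg : Measurable g) (hv : Measurable v) :
    ∫⁻ x, (∫⁻ y, g (x - y) * v y) ^ 2 ≤ (∫⁻ z, g z) ^ 2 * ∫⁻ y, v y ^ 2 := by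
  calc _ ≤ ∫⁻ x, (∫⁻ z, g z) * ∫⁻ y, g (x - y) * v y ^ 2 := by
        refine lintegral_mono fun x => (cs _ (by fun_prop) hv).trans_eq ?_
        rw [lintegral_sub_left_eq_self g x]
    _ = (∫⁻ z, g z) * ∫⁻ x, ∫⁻ y, g (x - y) * v y ^ 2 := by
        rw [lintegral_const_mul]
        exact Measurable.lintegral_prod_right' (f := fun p : (Fin n → ℂ) × (Fin n → ℂ) =>
          g (p.1 - p.2) * v p.2 ^ 2) (by fun_prop)
    _ = (∫⁻ z, g z) * ∫⁻ y, (∫⁻ z, g z) * v y ^ 2 := by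
        rw [lintegral_lintegral_swap (by unfold Function.uncurry; fun_prop)]
        congr 1
        refine lintegral_congr fun y => ?_
        rw [lintegral_mul_const _ (by fun_prop), lintegral_sub_right_eq_self g y]
    _ = _ := by
        rw [lintegral_const_mul _ (by fun_prop)]; ring

lemma Phi_cont {n : ℕ} (P H : Matrix (Fin n) (Fin n) ℂ) : Continuous (PhiW P H) := by
  unfold PhiW dotC Matrix.mulVec dotProduct
  simp only [Pi.star_apply]
  fun_prop

lemma exp_sq (a h : ℝ) : ENNReal.ofReal (Real.exp (-2 * a / h)) =
    ENNReal.ofReal (Real.exp (-a / h)) ^ 2 := by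
  rw [← ENNReal.ofReal_pow (Real.exp_pos _).le, ← Real.exp_nat_mul]
  congr 2; push_cast; ring

lemma pointwise {n : ℕ} (P H : Matrix (Fin n) (Fin n) ℂ) (hH : H.IsHermitian) (h : ℝ)
    (u : (Fin n → ℂ) → ℂ) (x : Fin n → ℂ) :
    ‖PiOp P H h u x‖ₑ * ENNReal.ofReal (Real.exp (-PhiW P H x / h)) ≤
      ‖(2 : ℂ)^n * H.det / ((Real.pi : ℂ) * (h : ℂ))^n‖ₑ *
        ∫⁻ y, ENNReal.ofReal (Real.exp (-qH H (x - y) / h)) *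
          (‖u y‖ₑ * ENNReal.ofReal (Real.exp (-PhiW P H y / h))) := by
  unfold PiOp
  rw [enorm_mul, mul_assoc]
  gcongr
  refine (mul_le_mul_left (enorm_integral_le_lintegral_enorm _) _).trans ?_
  rw [← lintegral_mul_const' _ _ ENNReal.ofReal_ne_top]
  refine lintegral_mono fun y => le_of_eq ?_
  have e1 : ‖Complex.exp (2 * psiW P H x (star y) / (h : ℂ))‖ₑ =
      ENNReal.ofReal (Real.exp ((2 * (psiW P H x (star y)).re) / h)) := by
    rw [← ofReal_norm, Complex.norm_exp]
    congr 2
    rw [Complex.div_ofReal_re]; simp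
  have e2 : ‖(Real.exp (-2 * PhiW P H y / h) : ℂ)‖ₑ =
      ENNReal.ofReal (Real.exp (-2 * PhiW P H y / h)) := by
    rw [← ofReal_norm, Complex.norm_real, Real.norm_of_nonneg (Real.exp_pos _).le]
  rw [enorm_mul, enorm_mul, e1, e2, key P H hH]
  have : ∀ a b c : ℝ≥0∞, ∀ d : ℝ≥0∞, a * b * c * d = (a * c * d) * b := by intros; ring
  rw [this, mul_comm ‖u y‖ₑ, ← mul_assoc]
  congr 1
  rw [← ENNReal.ofReal_mul (Real.exp_pos _).le, ← ENNReal.ofReal_mul (by positivity),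
    ← ENNReal.ofReal_mul (Real.exp_pos _).le, ← Real.exp_add, ← Real.exp_add, ← Real.exp_add]
  congr 2; ring

/-- The operator `Π` is bounded on `L²(ℂⁿ, e^{−2Φ/h}L(dx))`, uniformly in `0 < h ≤ 1`. -/
theorem stmt12 {n : ℕ} (P H : Matrix (Fin n) (Fin n) ℂ)
    (hP : P.IsSymm) (hHpos : H.PosDef) :
    ∃ C : ℝ, 0 < C ∧ ∀ h : ℝ, 0 < h → h ≤ 1 →
      ∀ u : (Fin n → ℂ) → ℂ, Measurable u →
        (∫⁻ x : Fin n → ℂ,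
            (‖PiOp P H h u x‖₊ : ℝ≥0∞)^2 * ENNReal.ofReal (Real.exp (-2 * PhiW P H x / h))) ≤
          ENNReal.ofReal (C^2) *
            ∫⁻ x : Fin n → ℂ,
              (‖u x‖₊ : ℝ≥0∞)^2 * ENNReal.ofReal (Real.exp (-2 * PhiW P H x / h)) := by
  obtain ⟨d, hd, hq⟩ := q_lower hHpos
  refine ⟨2 ^ n * ‖H.det‖ / d ^ n + 1, by positivity, fun h h0 _ u hu => ?_⟩
  simp only [exp_sq, ← mul_pow, ← enorm_eq_nnnorm]
  set g : (Fin n → ℂ) → ℝ≥0∞ := fun z => ENNReal.ofReal (Real.exp (-qH H z / h)) with hgdef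
  set v : (Fin n → ℂ) → ℝ≥0∞ :=
    fun y => ‖u y‖ₑ * ENNReal.ofReal (Real.exp (-PhiW P H y / h)) with hvdef
  set c : ℝ≥0∞ := ‖(2 : ℂ)^n * H.det / ((Real.pi : ℂ) * (h : ℂ))^n‖ₑ with hc
  have hg : Measurable g := by
    have := (q_cont H).measurable
    fun_prop
  have hv : Measurable v := by
    have := (Phi_cont P H).measurable
    fun_prop
  have hcg : c * ∫⁻ z, g z ≤ ENNReal.ofReal (2 ^ n * ‖H.det‖ / d ^ n + 1) := by
    have hG : ∫⁻ z, g z ≤ ENNReal.ofReal ((Real.pi / (d / h)) ^ n) := by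
      rw [← gauss_bound (div_pos hd h0)]
      refine lintegral_mono fun z => ENNReal.ofReal_le_ofReal (Real.exp_le_exp.2 ?_)
      have := div_le_div_of_nonneg_right (hq z) h0.le
      calc -qH H z / h = -(qH H z / h) := by ring
        _ ≤ -((d * ∑ i, ‖z i‖ ^ 2) / h) := by linarith
        _ = _ := by ring
    calc _ ≤ c * ENNReal.ofReal ((Real.pi / (d / h)) ^ n) := by gcongr
      _ ≤ _ := by
        rw [hc, ← ofReal_norm, ← ENNReal.ofReal_mul (norm_nonneg _)]
        refine ENNReal.ofReal_le_ofReal ?_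
        have : ‖(2 : ℂ)^n * H.det / ((Real.pi : ℂ) * (h : ℂ))^n‖ * (Real.pi / (d / h)) ^ n =
            2 ^ n * ‖H.det‖ / d ^ n := by
          simp only [norm_div, norm_mul, norm_pow, Complex.norm_real,
            Real.norm_of_nonneg h0.le, Real.norm_of_nonneg Real.pi_pos.le, Complex.norm_ofNat]
          have := Real.pi_pos
          rw [div_pow, div_pow, mul_pow]
          field_simp
        linarith
  calc _ ≤ ∫⁻ x, c ^ 2 * (∫⁻ y, g (x - y) * v y) ^ 2 := by
        refine lintegral_mono fun x => ?_
        rw [← mul_pow]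
        exact pow_le_pow_left' (pointwise P H hHpos.1 h u x) 2
    _ = c ^ 2 * ∫⁻ x, (∫⁻ y, g (x - y) * v y) ^ 2 := by
        rw [lintegral_const_mul' _ _ (by simp [hc])]
    _ ≤ c ^ 2 * ((∫⁻ z, g z) ^ 2 * ∫⁻ y, v y ^ 2) := by gcongr; exact schur hg hv
    _ = (c * ∫⁻ z, g z) ^ 2 * ∫⁻ y, v y ^ 2 := by ring
    _ ≤ _ := by
        rw [ENNReal.ofReal_pow (by positivity)]
        gcongr
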